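/- Let n ≥ 1 and let L : ℝⁿ × ℝⁿ → ℝ be C¹. Suppose there are constants a, ã, a' > 0 and b, b̃, b' ∈ ℝ such that a|v|² − b ≤ L(q,v) ≤ ã|v|² + b̃ and E(q,v) ≥ a'|v|² − b' for all (q,v). Fix k ∈ ℝ, and let γ_h : [0,T_h] → ℝⁿ be a sequence of C¹ curves with T_h > 0, T_h → 0, and (1/T_h)·∫₀^{T_h} [E(γ_h(t), γ_h'(t)) − k] dt → 0 as h → ∞. Then ∫₀^{T_h} [L(γ_h(t), γ_h'(t)) + k] dt → 0 as h → ∞. -/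

import Mathlib

open MeasureTheory Filter

/-- The energy associated with a Lagrangian `L` in local coordinates:
`E(q,v) = ∂_v L(q,v)[v] - L(q,v)`. -/
noncomputable def energy {n : ℕ} (L : EuclideanSpace ℝ (Fin n) × EuclideanSpace ℝ (Fin n) → ℝ)
    (q v : EuclideanSpace ℝ (Fin n)) : ℝ :=
  fderiv ℝ (fun w => L (q, w)) v v - L (q, v)

theorem energy_eq_fderiv_apply {n : ℕ}
    {L : EuclideanSpace ℝ (Fin n) × EuclideanSpace ℝ (Fin n) → ℝ} (hL : Differentiable ℝ L)
    (q v : EuclideanSpace ℝ (Fin n)) :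
    energy L q v = fderiv ℝ L (q, v) (0, v) - L (q, v) := by
  have h : HasFDerivAt (fun w => L (q, w)) _ v :=
    (hL (q, v)).hasFDerivAt.comp v (hasFDerivAt_prodMk_right q v)
  simp [energy, h.fderiv]

theorem continuous_energy {n : ℕ}
    {L : EuclideanSpace ℝ (Fin n) × EuclideanSpace ℝ (Fin n) → ℝ} (hL : ContDiff ℝ 1 L) :
    Continuous fun p : EuclideanSpace ℝ (Fin n) × EuclideanSpace ℝ (Fin n) =>
      energy L p.1 p.2 := by
  simp_rw [energy_eq_fderiv_apply (hL.differentiable one_ne_zero)]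
  have := hL.continuous
  have := hL.continuous_fderiv one_ne_zero
  fun_prop

/-- Integrating a pointwise inequality `c * f + d ≤ g` between continuous functions. -/
theorem mul_integral_add_le_integral {f g : ℝ → ℝ} (hf : Continuous f) (hg : Continuous g)
    {c d τ : ℝ} (hτ : 0 ≤ τ) (h : ∀ t, c * f t + d ≤ g t) :
    c * (∫ t in (0:ℝ)..τ, f t) + τ * d ≤ ∫ t in (0:ℝ)..τ, g t := by
  have hcf : Continuous fun t => c * f t := by fun_prop
  calc c * (∫ t in (0:ℝ)..τ, f t) + τ * d = ∫ t in (0:ℝ)..τ, (c * f t + d) := by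
        rw [intervalIntegral.integral_add (hcf.intervalIntegrable _ _)
          (continuous_const.intervalIntegrable _ _)]
        simp
    _ ≤ ∫ t in (0:ℝ)..τ, g t :=
        intervalIntegral.integral_mono hτ ((hcf.add continuous_const).intervalIntegrable _ _)
          (hg.intervalIntegrable _ _) h

/-- Palais–Smale sequences whose times tend to zero are at action level zero: if
`a|v|² - b ≤ L(q,v) ≤ atil|v|² + btil`, `E(q,v) ≥ a'|v|² - b'`, `T_h → 0` and the mean energy
defect `(1/T_h)∫₀^{T_h}[E(γ_h,γ_h') - k] dt` tends to `0`, then the actions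
`∫₀^{T_h}[L(γ_h,γ_h') + k] dt` tend to `0`. -/
theorem action_tendsto_zero_of_times_tendsto_zero
    (n : ℕ) (hn : 1 ≤ n)
    (L : EuclideanSpace ℝ (Fin n) × EuclideanSpace ℝ (Fin n) → ℝ) (hL : ContDiff ℝ 1 L)
    (a atil a' : ℝ) (ha : 0 < a) (hatil : 0 < atil) (ha' : 0 < a') (b btil b' : ℝ)
    (hLlow : ∀ q v : EuclideanSpace ℝ (Fin n), a * ‖v‖ ^ 2 - b ≤ L (q, v))
    (hLup : ∀ q v : EuclideanSpace ℝ (Fin n), L (q, v) ≤ atil * ‖v‖ ^ 2 + btil)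
    (hE : ∀ q v : EuclideanSpace ℝ (Fin n), a' * ‖v‖ ^ 2 - b' ≤ energy L q v)
    (k : ℝ) (γ : ℕ → ℝ → EuclideanSpace ℝ (Fin n)) (T : ℕ → ℝ)
    (hγ : ∀ h, ContDiff ℝ 1 (γ h)) (hT : ∀ h, 0 < T h)
    (hT0 : Tendsto T atTop (nhds 0))
    (hPS : Tendsto
      (fun h => (T h)⁻¹ * ∫ t in (0:ℝ)..(T h), (energy L (γ h t) (deriv (γ h) t) - k))
      atTop (nhds 0)) :
    Tendsto (fun h => ∫ t in (0:ℝ)..(T h), (L (γ h t, deriv (γ h) t) + k)) atTop (nhds 0) := by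
  have hcurve : ∀ h, Continuous fun t => (γ h t, deriv (γ h) t) := fun h =>
    (hγ h).continuous.prodMk ((hγ h).continuous_deriv le_rfl)
  have hspeed : ∀ h, Continuous fun t => ‖deriv (γ h) t‖ ^ 2 := fun h =>
    (hcurve h).snd.norm.pow 2
  have haction : ∀ h, Continuous fun t => L (γ h t, deriv (γ h) t) + k := fun h =>
    (hL.continuous.comp (hcurve h)).add continuous_const
  have hdefect : ∀ h, Continuous fun t => energy L (γ h t) (deriv (γ h) t) - k := fun h =>
    ((continuous_energy hL).comp (hcurve h)).sub continuous_const
  have hkinetic : Tendsto (fun h => ∫ t in (0:ℝ)..(T h), ‖deriv (γ h) t‖ ^ 2)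
      atTop (nhds 0) := by
    have hbound := (hT0.mul (hPS.add_const (b' + k))).div_const a'
    rw [zero_mul, zero_div] at hbound
    refine squeeze_zero (fun h => intervalIntegral.integral_nonneg (hT h).le
      fun t _ => by positivity) (fun h => ?_) hbound
    have key := mul_integral_add_le_integral (c := a') (d := -b' - k) (hspeed h) (hdefect h)
      (hT h).le fun t => by linarith [hE (γ h t) (deriv (γ h) t)]
    rw [le_div_iff₀ ha', mul_add, mul_inv_cancel_left₀ (hT h).ne']
    linarith
  have hlow := (hkinetic.const_mul a).add (hT0.mul_const (k - b))
  have hup := (hkinetic.const_mul atil).add (hT0.mul_const (btil + k))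
  rw [mul_zero, zero_mul, add_zero] at hlow hup
  refine tendsto_of_tendsto_of_tendsto_of_le_of_le hlow hup (fun h => ?_) (fun h => ?_)
  · exact mul_integral_add_le_integral (hspeed h) (haction h) (hT h).le
      fun t => by linarith [hLlow (γ h t) (deriv (γ h) t)]
  · have key := mul_integral_add_le_integral (c := -atil) (d := -(btil + k))
      (g := fun t => -(L (γ h t, deriv (γ h) t) + k)) (hspeed h) (haction h).neg (hT h).le fun t => by linarith [hLup (γ h t) (deriv (γ h) t)]
    rw [intervalIntegral.integral_neg] at key
    linarith
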